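/- For every G-set Γ, the closed convex cone σ(Γ) = { α ∈ ℝ³ : ⟨α, s_Γ(v)⟩ ≥ 0 for all v ∈ ℕ³ } is 3-dimensional, i.e., σ(Γ) has nonempty interior in ℝ³. -/

import Mathlib

open scoped BigOperators Classical

namespace GH

/-- Exponent vectors of monomials `x^m y^n z^p`. -/
abbrev N3 : Type := ℕ × ℕ × ℕ

/-- The lattice `ℤ³`. -/
abbrev Z3 : Type := ℤ × ℤ × ℤ

/-- Inclusion `ℕ³ → ℤ³`. -/
def toZ (v : N3) : Z3 := ((v.1 : ℤ), (v.2.1 : ℤ), (v.2.2 : ℤ))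

/-- The weight map `wt(m,n,p) = m + a·n + (r−a)·p (mod r)` on `ℤ³`. -/
def wtZ (r a : ℕ) (v : Z3) : ZMod r :=
  (v.1 : ZMod r) + (a : ZMod r) * (v.2.1 : ZMod r) + ((r - a : ℕ) : ZMod r) * (v.2.2 : ZMod r)

/-- The weight map on `ℕ³`. -/
def wtN (r a : ℕ) (v : N3) : ZMod r := wtZ r a (toZ v)

/-- A `G`-set: contains the origin, closed under taking summands, and the weight map
restricted to it is a bijection onto `ℤ/rℤ`. -/
structure IsGSet (r a : ℕ) (Γ : Set N3) : Prop where
  zero_mem : (0, 0, 0) ∈ Γ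
  dclosed : ∀ u v : N3, u + v ∈ Γ → u ∈ Γ ∧ v ∈ Γ
  bij : Set.BijOn (wtN r a) Γ Set.univ

/-- `wt_Γ(v)`: the (unique, for a `G`-set) element of `Γ` of the same weight as `v`. -/
noncomputable def wtG (r a : ℕ) (Γ : Set N3) (v : N3) : N3 :=
  if h : ∃ w, w ∈ Γ ∧ wtN r a w = wtN r a v then h.choose else (0, 0, 0)

/-- `(m,n)` is a y-valley of `Γ`. -/
def IsYValley (Γ : Set N3) (m n : ℕ) : Prop :=
  (m, n, 0) ∈ Γ ∧ (m + 1, n, 0) ∈ Γ ∧ (m, n + 1, 0) ∈ Γ ∧ (m + 1, n + 1, 0) ∉ Γ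

/-- `(m,n)` is a z-valley of `Γ`. -/
def IsZValley (Γ : Set N3) (m n : ℕ) : Prop :=
  (m, 0, n) ∈ Γ ∧ (m + 1, 0, n) ∈ Γ ∧ (m, 0, n + 1) ∈ Γ ∧ (m + 1, 0, n + 1) ∉ Γ

/-- A primitive `G`-set: it has a y-valley `(i_y, 0)` and a z-valley `(i_z, 0)`. -/
def IsPrimG (Γ : Set N3) : Prop := (∃ p : ℕ, IsYValley Γ p 0) ∧ (∃ p : ℕ, IsZValley Γ p 0)

/-- `s_Γ(v) = v − wt_Γ(v) ∈ ℤ³`. -/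
noncomputable def sG (r a : ℕ) (Γ : Set N3) (v : N3) : Z3 := toZ v - toZ (wtG r a Γ v)

/-- The submonoid `S(Γ)` of `ℤ³` generated by all `s_Γ(v)`. -/
noncomputable def SMon (r a : ℕ) (Γ : Set N3) : AddSubmonoid Z3 :=
  AddSubmonoid.closure (Set.range (sG r a Γ))

/-- The lattice `M = { u ∈ ℤ³ : wt(u) = 0 }` of `G`-invariant monomials. -/
def latM (r a : ℕ) : Set Z3 := { u | wtZ r a u = 0 }

/-- The standard pairing of `ℝ³` with `ℤ³`. -/
def dotR (α : ℝ × ℝ × ℝ) (u : Z3) : ℝ :=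
  α.1 * (u.1 : ℝ) + α.2.1 * (u.2.1 : ℝ) + α.2.2 * (u.2.2 : ℝ)

/-- The cone `σ(Γ) = { α ∈ ℝ³ : ⟨α, s_Γ(v)⟩ ≥ 0 for all v ∈ ℕ³ }`. -/
noncomputable def sigmaCone (r a : ℕ) (Γ : Set N3) : Set (ℝ × ℝ × ℝ) :=
  { α | ∀ v : N3, 0 ≤ dotR α (sG r a Γ v) }

/-- `span(u₁,…,u_t)`: all `v ∈ ℕ³` dominated componentwise by some `u_s`. -/
def spanSet (s : Set N3) : Set N3 := { v | ∃ u ∈ s, v ≤ u }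

/-- `i(Γ)`: the largest `m` with `(m,0,0) ∈ Γ`. -/
noncomputable def iOf (Γ : Set N3) : ℕ := sSup { m : ℕ | (m, 0, 0) ∈ Γ }

/-- `j(Γ)`: the largest `n` with `(0,n,0) ∈ Γ`. -/
noncomputable def jOf (Γ : Set N3) : ℕ := sSup { n : ℕ | (0, n, 0) ∈ Γ }

/-- `k(Γ)`: the largest `p` with `(0,0,p) ∈ Γ`. -/
noncomputable def kOf (Γ : Set N3) : ℕ := sSup { p : ℕ | (0, 0, p) ∈ Γ }

/-- `c(w) = max { c : w − c·v ∈ ℕ³ }` (componentwise). -/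
noncomputable def cmax (v w : N3) : ℕ := sSup { c : ℕ | c • v ≤ w }

/-- The `G`-igsaw transformation of `Γ` in the direction of `u`:
`T_u(Γ) = { w + c(w)·(u − v) : w ∈ Γ }` where `v = wt_Γ(u)`. -/
noncomputable def jig (r a : ℕ) (Γ : Set N3) (u : N3) : Set N3 :=
  { w' | ∃ w ∈ Γ,
      toZ w' = toZ w + (cmax (wtG r a Γ u) w) • (toZ u - toZ (wtG r a Γ u)) }

/-- The upper transformation `TU(Γ)`. -/
noncomputable def TU (r a : ℕ) (Γ : Set N3) : Set N3 := jig r a Γ (iOf Γ + 1, 0, 0)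

/-- The right transformation `TR(Γ)`. -/
noncomputable def TR (r a : ℕ) (Γ : Set N3) : Set N3 := jig r a Γ (0, jOf Γ + 1, 0)

/-- The left transformation `TL(Γ)`. -/
noncomputable def TL (r a : ℕ) (Γ : Set N3) : Set N3 := jig r a Γ (0, 0, kOf Γ + 1)

/-- The y-valley of `Γ` (chosen by choice; unique for a `G`-set having one). -/
noncomputable def yValley (Γ : Set N3) : ℕ × ℕ :=
  if h : ∃ p : ℕ × ℕ, IsYValley Γ p.1 p.2 then h.choose else (0, 0)

/-- The z-valley of `Γ` (chosen by choice; unique for a `G`-set having one). -/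
noncomputable def zValley (Γ : Set N3) : ℕ × ℕ :=
  if h : ∃ p : ℕ × ℕ, IsZValley Γ p.1 p.2 then h.choose else (0, 0)

/-- The upper right transformation `TUR(Γ)`, in the direction `(i_y+1, j_y+1, 0)`. -/
noncomputable def TUR (r a : ℕ) (Γ : Set N3) : Set N3 :=
  jig r a Γ ((yValley Γ).1 + 1, (yValley Γ).2 + 1, 0)

/-- The upper left transformation `TUL(Γ)`, in the direction `(i_z+1, 0, k_z+1)`. -/
noncomputable def TUL (r a : ℕ) (Γ : Set N3) : Set N3 :=
  jig r a Γ ((zValley Γ).1 + 1, 0, (zValley Γ).2 + 1)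

/-- The bound `min{j, k, j − j_y, k − k_z}` for the triangle of transformations. -/
noncomputable def minBound (Γ : Set N3) : ℕ :=
  min (min (jOf Γ) (kOf Γ)) (min (jOf Γ - (yValley Γ).2) (kOf Γ - (zValley Γ).2))

/-- The triangle of transformations `Θ(Γ)`. -/
noncomputable def Theta (r a : ℕ) (Γ : Set N3) : Set (Set N3) :=
  { Γ' | ∃ p q : ℕ, p + q ≤ minBound Γ ∧ Γ' = (TUR r a)^[p] ((TUL r a)^[q] Γ) }

/-- The recursion step producing `Γ_{n+1}` from `Γ_n`. -/
noncomputable def nextGamma (r a : ℕ) (Γ : Set N3) : Set N3 :=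
  if jOf Γ < kOf Γ then TU r a ((TUR r a)^[jOf Γ] Γ)
  else TU r a ((TUL r a)^[kOf Γ] Γ)

/-- The sequence of primitive `G`-sets; `GammaSeq r a b (n-1)` is `Γ_n`,
starting from `Γ₁ = span((1,0,0),(0,b−1,0),(0,0,r−b−1))`. -/
noncomputable def GammaSeq (r a b : ℕ) : ℕ → Set N3
  | 0 => spanSet {(1, 0, 0), (0, b - 1, 0), (0, 0, r - b - 1)}
  | n + 1 => nextGamma r a (GammaSeq r a b n)

/-- A finite set `P` of cells in the half plane `ℕ × ℤ`, closed under moving towards the origin,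
that is a fundamental domain for the subgroup `L` of `ℤ²`. The cell `(m, n)` stands for the monomial
`x^m y^n` if `0 ≤ n` and for `x^m z^(-n)` if `n ≤ 0`. -/
structure IsTile (L P : ℤ → ℤ → Prop) (A j k : ℤ) : Prop where
  zero : L 0 0
  sub : ∀ {m n m' n' : ℤ}, L m n → L m' n' → L (m - m') (n - n')
  nonneg : ∀ {m n : ℤ}, P m n → 0 ≤ m
  mono : ∀ {m n m' n' : ℤ}, P m n → 0 ≤ m' → m' ≤ m →
    (0 ≤ n' ∧ n' ≤ n ∨ n ≤ n' ∧ n' ≤ 0) → P m' n'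
  inj : ∀ {m n m' n' : ℤ}, P m n → P m' n' → L (m - m') (n - n') → m = m' ∧ n = n'
  surj : ∀ m n : ℤ, ∃ m' n' : ℤ, P m' n' ∧ L (m - m') (n - n')
  row : ∀ m : ℤ, P m 0 ↔ 0 ≤ m ∧ m < A
  col : ∀ n : ℤ, P 0 n ↔ -k ≤ n ∧ n ≤ j

/-- Reflection in the `x`-axis, exchanging the roles of `y` and `z`. -/
def mirror (Q : ℤ → ℤ → Prop) (m n : ℤ) : Prop := Q m (-n)

lemma mirror_mirror (Q : ℤ → ℤ → Prop) : mirror (mirror Q) = Q := by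
  funext m n
  simp [mirror]

/-- The cells outside `P` reached from `P` by multiplication with a variable. -/
def IsBorder (P : ℤ → ℤ → Prop) (m n : ℤ) : Prop :=
  ¬ P m n ∧ (P (m - 1) n ∨ 0 < n ∧ P m (n - 1) ∨ n < 0 ∧ P m (n + 1))

/-- The value of the weight `(·, β, γ)` on `y^n` if `0 ≤ n`, and on `z^(-n)` if `n ≤ 0`. -/
noncomputable def bend (β γ : ℝ) (n : ℤ) : ℝ := β * (n.toNat : ℝ) + γ * ((-n).toNat : ℝ)

/-- Some weight is strictly larger on each border cell than on its representative in `P`. -/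
def HasStrictWeight (L P : ℤ → ℤ → Prop) : Prop :=
  ∃ α β γ : ℝ, 0 < β + γ ∧ ∀ m n m' n' : ℤ, IsBorder P m n → P m' n' → L (m - m') (n - n') →
    0 < α * ((m : ℝ) - m') + bend β γ n - bend β γ n'

lemma HasStrictWeight.mirror {L P : ℤ → ℤ → Prop} (h : HasStrictWeight L P) :
    HasStrictWeight (mirror L) (mirror P) := by
  obtain ⟨α, β, γ, hpos, h⟩ := h
  refine ⟨α, γ, β, by linarith, fun m n m' n' hb hP hL => ?_⟩
  have hb' : IsBorder P m (-n) := by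
    obtain ⟨h1, h2⟩ := hb
    refine ⟨h1, ?_⟩
    rcases h2 with h2 | ⟨hn, h2⟩ | ⟨hn, h2⟩
    · exact Or.inl h2
    · refine Or.inr (Or.inr ⟨by omega, ?_⟩)
      have e : -n + 1 = -(n - 1) := by ring
      rw [e]; exact h2
    · refine Or.inr (Or.inl ⟨by omega, ?_⟩)
      have e : -n - 1 = -(n + 1) := by ring
      rw [e]; exact h2
  have hL' : L (m - m') (-n - -n') := by
    have e : -n - -n' = -(n - n') := by ring
    rw [e]; exact hL
  have := h m (-n) m' (-n') hb' hP hL'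
  simp only [bend, neg_neg] at this ⊢
  linarith

/-- The part of `P` in the upper half plane is a union of the two rectangles `A × (t + 1)` and
`B × (j + 1)`. -/
structure UpperShape (L P : ℤ → ℤ → Prop) (A j k B t : ℤ) : Prop where
  pos : 0 < B
  lt : B < A
  nonneg : 0 ≤ t
  le : t ≤ j
  shape : ∀ m n : ℤ, 0 ≤ n → (P m n ↔ 0 ≤ m ∧ (m < A ∧ n ≤ t ∨ m < B ∧ n ≤ j))
  rel : L B (t + 1 + k)

lemma exists_greatest {Q : ℤ → Prop} {x b : ℤ} (hx : Q x) (hb : ∀ z, Q z → z ≤ b) :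
    ∃ z, x ≤ z ∧ Q z ∧ ∀ w, Q w → w ≤ z := by
  obtain ⟨z, hz, h⟩ := Int.exists_greatest_of_bdd ⟨b, hb⟩ ⟨x, hx⟩
  exact ⟨z, h x hx, hz, h⟩

namespace IsTile

variable {L P : ℤ → ℤ → Prop} {A j k : ℤ}

lemma sub_eq (T : IsTile L P A j k) {m n m' n' x y : ℤ} (h : L m n) (h' : L m' n')
    (hx : x = m - m') (hy : y = n - n') : L x y := by
  subst hx hy
  exact T.sub h h'

lemma neg_eq (T : IsTile L P A j k) {m n x y : ℤ} (h : L m n) (hx : x = -m) (hy : y = -n) :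
    L x y :=
  T.sub_eq T.zero h (by omega) (by omega)

lemma add_eq (T : IsTile L P A j k) {m n m' n' x y : ℤ} (h : L m n) (h' : L m' n')
    (hx : x = m + m') (hy : y = n + n') : L x y :=
  T.sub_eq h (T.neg_eq h' rfl rfl) (by omega) (by omega)

lemma inj_eq (T : IsTile L P A j k) {m n m' n' x y : ℤ} (h : P m n) (h' : P m' n') (hL : L x y)
    (hx : x = m - m') (hy : y = n - n') : m = m' ∧ n = n' := by
  subst hx hy
  exact T.inj h h' hL

lemma bounds (T : IsTile L P A j k) {m n : ℤ} (h : P m n) :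
    0 ≤ m ∧ m < A ∧ -k ≤ n ∧ n ≤ j := by
  have h0 := T.nonneg h
  have h1 := (T.row m).1 (T.mono h h0 le_rfl (by omega))
  have h2 := (T.col n).1 (T.mono h le_rfl h0 (by omega))
  omega

lemma mirror (T : IsTile L P A j k) : IsTile (mirror L) (mirror P) A k j where
  zero := T.zero
  sub h h' := T.sub_eq h h' rfl (by omega)
  nonneg h := T.nonneg h
  mono h h1 h2 h3 := T.mono h h1 h2 (by omega)
  inj h h' hL := by
    have := T.inj_eq h h' hL rfl (by omega)
    omega
  surj m n := by
    obtain ⟨m', n', h, hL⟩ := T.surj m (-n)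
    refine ⟨m', -n', ?_, ?_⟩
    · simpa [GH.mirror] using h
    · have e : -(n - -n') = -n - n' := by ring
      unfold GH.mirror
      rwa [e]
  row m := T.row m
  col n := (T.col (-n)).trans (by omega)

/-- A cell above the top of `P` whose left neighbour represents a right end of a row of `P` is
represented by the lowest cell of the left column of `P`. -/
lemma rel_of_corner (T : IsTile L P A j k) {m n p q : ℤ} (hn : 0 ≤ n) (h : P m n)
    (h' : ¬ P m (n + 1)) (hp : P p q) (hp' : ¬ P (p + 1) q) (hL : L (m - 1 - p) (n + 1 - q)) :
    L m (n + 1 + k) := by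
  obtain ⟨m', n', hP, hrep⟩ := T.surj m (n + 1)
  have hb := T.bounds hP
  have hn' : n' ≤ 0 := by
    by_contra hc
    have := T.inj_eq h (T.mono (n' := n' - 1) hP hb.1 le_rfl (by omega)) hrep rfl (by omega)
    obtain ⟨rfl, e⟩ := this
    obtain rfl : n' = n + 1 := by omega
    exact h' hP
  have hm' : m' = 0 := by
    by_contra hc
    have hP' : P (m' - 1) n' := T.mono hP (by omega) (by omega) (by omega)
    have := T.inj_eq hP' hp (T.sub_eq hL hrep rfl rfl) (by omega) (by omega)
    obtain ⟨e, rfl⟩ := this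
    obtain rfl : m' = p + 1 := by omega
    exact hp' hP
  have hk : n' = -k := by
    by_contra hc
    have := T.inj_eq h ((T.col (n' - 1)).2 (by omega)) hrep (by omega) (by omega)
    omega
  subst hm' hk
  simpa using hrep

lemma rel_of_valley (T : IsTile L P A j k) {m n : ℤ} (hn : 0 ≤ n) (h : P (m + 1) n)
    (h1 : P m (n + 1)) (h2 : ¬ P (m + 1) (n + 1)) : L (m + 1) (n + 1 + k) :=
  T.rel_of_corner hn h h2 h1 h2 (by simpa using T.zero)

/-- There is at most one valley in the upper half plane. -/
lemma upper_dichotomy (T : IsTile L P A j k) :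
    (∀ m n : ℤ, 0 ≤ n → (P m n ↔ 0 ≤ m ∧ m < A ∧ n ≤ j)) ∨
      ∃ B t : ℤ, t < j ∧ UpperShape L P A j k B t := by
  have hA : 0 < A ∧ 0 ≤ j ∧ 0 ≤ k := by
    have h0 := T.surj 0 0
    obtain ⟨m, n, h, -⟩ := h0
    have hb := T.bounds h
    have := (T.col 0).1 (T.mono h le_rfl hb.1 (by omega))
    omega
  obtain ⟨b, hb0, hb, hbmax⟩ := exists_greatest (Q := fun m => P m j) ((T.col j).2 (by omega))
    (fun z hz => (T.bounds hz).2.1.le)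
  have hbA := T.bounds hb
  rcases eq_or_ne (b + 1) A with e | hne
  · left
    refine fun m n hn => ⟨fun h => ?_, fun h => T.mono hb (by omega) (by omega) (by omega)⟩
    have := T.bounds h
    omega
  · right
    obtain ⟨t, ht0, ht, htmax⟩ := exists_greatest (Q := fun n => P (b + 1) n) (x := 0)
      ((T.row _).2 (by omega)) (fun z hz => (T.bounds hz).2.2.2)
    have htb := T.bounds ht
    have htj : t < j := by
      rcases lt_or_eq_of_le htb.2.2.2 with h | rfl
      · exact h
      · have := hbmax _ ht
        omega
    have hnt : ¬ P (b + 1) (t + 1) := fun h => by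
      have := htmax _ h
      omega
    have hrel := T.rel_of_valley ht0 ht (T.mono hb hb0 le_rfl (by omega)) hnt
    have hwide : P (A - 1) t := by
      obtain ⟨c, hcb, hc, hcmax⟩ := exists_greatest (Q := fun m => P m t) ht
        (fun z hz => (T.bounds hz).2.1.le)
      have hcA := T.bounds hc
      by_contra hcon
      have hcA' : c + 1 < A := by
        rcases lt_or_eq_of_le (show c + 1 ≤ A by omega) with h | h
        · exact h
        · obtain rfl : c = A - 1 := by omega
          exact absurd hc hcon
      obtain ⟨s, hs0, hs, hsmax⟩ := exists_greatest (Q := fun n => P (c + 1) n) (x := 0)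
        ((T.row _).2 (by omega)) (fun z hz => (T.bounds hz).2.2.2)
      have hst : s < t := by
        by_contra hge
        have := hcmax _ (T.mono (n' := t) hs (by omega) le_rfl (by omega))
        omega
      have hrel' := T.rel_of_valley hs0 hs (T.mono hc (by omega) le_rfl (by omega)) (fun h => by
        have := hsmax _ h
        omega)
      have := T.inj_eq ((T.row (c - b)).2 (by omega)) ((T.col (t - s)).2 (by omega))
        (T.sub hrel' hrel) (by omega) (by omega)
      omega
    refine ⟨b + 1, t, htj, ⟨by omega, by omega, ht0, by omega, fun m n hn => ⟨fun h => ?_, ?_⟩,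
      hrel⟩⟩
    · have hbd := T.bounds h
      by_cases hnt' : n ≤ t
      · omega
      · have : m < b + 1 := by
          by_contra hge
          have := htmax _ (T.mono (n' := n) h (by omega) (not_lt.1 hge) (by omega))
          omega
        omega
    · rintro ⟨h0, h | h⟩
      · exact T.mono hwide h0 (by omega) (by omega)
      · exact T.mono hb h0 (by omega) (by omega)

end IsTile

lemma bend_eq (γ : ℝ) (n : ℤ) : bend (1 - γ) γ n = ((n.toNat : ℤ) : ℝ) - γ * n := by
  have h : (n : ℝ) = ((n.toNat : ℤ) : ℝ) - (((-n).toNat : ℤ) : ℝ) := by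
    rw [← Int.cast_sub]
    congr 1
    omega
  rw [h, bend]
  push_cast
  ring

namespace IsTile

variable {L P : ℤ → ℤ → Prop} {A j k : ℤ}

lemma hasStrictWeight_of_shapes (T : IsTile L P A j k) {B C s t : ℤ}
    (hU : UpperShape L P A j k B s) (hD : UpperShape (GH.mirror L) (GH.mirror P) A k j C t)
    (hA : B + C = A) : HasStrictWeight L P := by
  obtain ⟨hB, hBA, hs0, hsj, hup, hrel⟩ := hU
  obtain ⟨hC, hCA, ht0, htk, hdn', hrel'⟩ := hD
  simp only [GH.mirror] at hdn' hrel'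
  have hdn : ∀ m n : ℤ, n ≤ 0 → (P m n ↔ 0 ≤ m ∧ (m < A ∧ -n ≤ t ∨ m < C ∧ -n ≤ k)) := by
    intro m n hn
    have := hdn' m (-n) (by omega)
    rwa [neg_neg] at this
  obtain ⟨α, γ, h1, h2⟩ : ∃ α γ : ℝ, α * B - γ * (s + 1 + k) = -s - 1 / 4 ∧
      α * C + γ * (t + 1 + j) = j + 3 / 4 := by
    have hBr : (0 : ℝ) < B := by exact_mod_cast hB
    have hCr : (0 : ℝ) < C := by exact_mod_cast hC
    have e1 : (0 : ℝ) < s + 1 + k := by exact_mod_cast (by omega : (0 : ℤ) < s + 1 + k)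
    have e2 : (0 : ℝ) < t + 1 + j := by exact_mod_cast (by omega : (0 : ℤ) < t + 1 + j)
    have hdet : (0 : ℝ) < B * (t + 1 + j) + C * (s + 1 + k) := by positivity
    refine ⟨((-s - 1 / 4) * (t + 1 + j) + (j + 3 / 4) * (s + 1 + k)) /
      (B * (t + 1 + j) + C * (s + 1 + k)), (B * (j + 3 / 4) - C * (-s - 1 / 4)) /
      (B * (t + 1 + j) + C * (s + 1 + k)), ?_, ?_⟩
    · field_simp
      ring
    · field_simp
      ring
  have val : ∀ p q m n m' n' : ℤ, m - m' = p * B + q * C →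
      n - n' = p * (s + 1 + k) - q * (t + 1 + j) →
      0 < 4 * ((n.toNat : ℤ) - n'.toNat) - p * (4 * s + 1) + q * (4 * j + 3) →
      0 < α * ((m : ℝ) - m') + bend (1 - γ) γ n - bend (1 - γ) γ n' := by
    intro p q m n m' n' e1 e2 e3
    have e1' : (m : ℝ) - m' = p * B + q * C := by exact_mod_cast e1
    have e2' : (n : ℝ) - n' = p * (s + 1 + k) - q * (t + 1 + j) := by exact_mod_cast e2
    have e3' : (0 : ℝ) < 4 * (((n.toNat : ℤ) : ℝ) - ((n'.toNat : ℤ) : ℝ)) - p * (4 * s + 1)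
      + q * (4 * j + 3) := by exact_mod_cast e3
    rw [bend_eq, bend_eq, e1']
    have : α * (p * B + q * C) + (((n.toNat : ℤ) : ℝ) - γ * n) - (((n'.toNat : ℤ) : ℝ) - γ * n')
        = (4 * (((n.toNat : ℤ) : ℝ) - ((n'.toNat : ℤ) : ℝ)) - p * (4 * s + 1)
          + q * (4 * j + 3)) / 4 := by
      linear_combination (p : ℝ) * h1 + (q : ℝ) * h2 - γ * e2'
    rw [this]
    linarith
  have rep : ∀ p q m n m' n' x y : ℤ, L x y → x = p * B + q * C →
      y = p * (s + 1 + k) - q * (t + 1 + j) → P m' n' → L (m - m') (n - n') →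
      P (m - x) (n - y) →
      0 < 4 * ((n.toNat : ℤ) - (n - y).toNat) - p * (4 * s + 1) + q * (4 * j + 3) →
      0 < α * ((m : ℝ) - m') + bend (1 - γ) γ n - bend (1 - γ) γ n' := by
    intro p q m n m' n' x y hxy hx hy hP hL hP' hpos
    obtain ⟨rfl, rfl⟩ := T.inj_eq hP hP' (T.sub_eq hxy hL rfl rfl) (by omega) (by omega)
    exact val p q _ _ _ _ (by rw [← hx]; ring) (by rw [← hy]; ring) hpos
  refine ⟨α, 1 - γ, γ, by linarith, fun m n m' n' hb hP hL => ?_⟩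
  obtain ⟨hnot, hb⟩ := hb
  have r12 : L A (s + k - t - j) := T.add_eq hrel hrel' (by omega) (by omega)
  have rn1 : L (-B) (-(s + 1 + k)) := T.neg_eq hrel rfl rfl
  have rn2 : L (-C) (t + 1 + j) := T.neg_eq hrel' rfl (by omega)
  have inU : ∀ x y : ℤ, 0 ≤ y → 0 ≤ x ∧ (x < A ∧ y ≤ s ∨ x < B ∧ y ≤ j) → P x y :=
    fun x y hy h => (hup x y hy).2 h
  have inD : ∀ x y : ℤ, y ≤ 0 → 0 ≤ x ∧ (x < A ∧ -y ≤ t ∨ x < C ∧ -y ≤ k) → P x y :=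
    fun x y hy h => (hdn x y hy).2 h
  have inCol : ∀ x y : ℤ, x = 0 → -k ≤ y → y ≤ j → P x y := by
    rintro x y rfl h h'
    exact (T.col y).2 ⟨h, h'⟩
  rcases hb with hb | ⟨hn, hb⟩ | ⟨hn, hb⟩
  · rcases le_total 0 n with hn | hn
    · rw [hup _ _ hn] at hb hnot
      by_cases hns : n ≤ s
      · refine rep 1 1 m n m' n' _ _ r12 (by omega) (by omega) hP hL
          (inCol _ _ (by omega) (by omega) (by omega)) (by omega)
      · refine rep 1 0 m n m' n' _ _ hrel (by omega) (by omega) hP hL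
          (inCol _ _ (by omega) (by omega) (by omega)) (by omega)
    · rw [hdn _ _ hn] at hb hnot
      by_cases hns : -n ≤ t
      · refine rep 1 1 m n m' n' _ _ r12 (by omega) (by omega) hP hL
          (inCol _ _ (by omega) (by omega) (by omega)) (by omega)
      · refine rep 0 1 m n m' n' _ _ hrel' (by omega) (by omega) hP hL
          (inCol _ _ (by omega) (by omega) (by omega)) (by omega)
  · rw [hup _ _ (by omega)] at hb hnot
    by_cases hm : m < B
    · refine rep 0 (-1) m n m' n' _ _ rn2 (by omega) (by omega) hP hL
        (inD _ _ (by omega) (by omega)) (by omega)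
    · refine rep 1 0 m n m' n' _ _ hrel (by omega) (by omega) hP hL
        (inD _ _ (by omega) (by omega)) (by omega)
  · rw [hdn _ _ (by omega)] at hb hnot
    by_cases hm : m < C
    · refine rep (-1) 0 m n m' n' _ _ rn1 (by omega) (by omega) hP hL
        (inU _ _ (by omega) (by omega)) (by omega)
    · refine rep 0 1 m n m' n' _ _ hrel' (by omega) (by omega) hP hL
        (inU _ _ (by omega) (by omega)) (by omega)

/-- The representative of the first cell to the right of a row of `P` lies in the left column. -/
lemma rep_right (T : IsTile L P A j k) {m n m' n' : ℤ} (hP : P (m - 1) n) (hnot : ¬ P m n)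
    (hP' : P m' n') (hL : L (m - m') (n - n')) : m' = 0 := by
  by_contra hc
  have hb := T.bounds hP'
  have h' : P (m' - 1) n' := T.mono hP' (by omega) (by omega) (by omega)
  obtain ⟨e, rfl⟩ := T.inj_eq hP h' hL (by omega) (by omega)
  obtain rfl : m = m' := by omega
  exact hnot hP'

lemma width_eq_add (T : IsTile L P A j k) {B C s t : ℤ}
    (hU : UpperShape L P A j k B s) (hD : UpperShape (GH.mirror L) (GH.mirror P) A k j C t)
    (hs : s < j) (ht : t < k) : B + C = A := by
  obtain ⟨hB, hBA, hs0, -, hup, hrel⟩ := hU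
  obtain ⟨hC, hCA, ht0, -, hdn, hrel'⟩ := hD
  simp only [GH.mirror] at hdn hrel'
  by_contra hne
  rcases lt_or_gt_of_ne hne with hlt | hgt
  · have := T.inj_eq ((T.row (B + C)).2 (by omega)) ((T.col (j + t - s - k)).2 (by omega))
      (T.add_eq hrel hrel' rfl rfl) (by omega) (by omega)
    omega
  · obtain ⟨m', q, hP, hL⟩ := T.surj A 0
    have hm' := T.rep_right (m := A) (n := 0) ((T.row _).2 (by omega))
      (fun h => by have := (T.row _).1 h; omega) hP hL
    have hq := T.bounds hP
    have hq1 : j < q + s + 1 := by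
      by_contra hc
      have := T.inj_eq ((hdn (A - B) k (by omega)).2 (by omega))
        ((T.col (q + s + 1)).2 (by omega)) (T.sub_eq hL hrel rfl rfl) (by omega) (by omega)
      omega
    have hq2 : q - t - 1 < -k := by
      by_contra hc
      have := T.inj_eq ((hup (A - C) j (by omega)).2 (by omega))
        ((T.col (q - t - 1)).2 (by omega)) (T.sub_eq hL hrel' rfl rfl) (by omega) (by omega)
      omega
    omega

/-- A rectangle in the upper half plane counts as a degenerate shape. -/
lemma upperShape_of_rect (T : IsTile L P A j k) {C t : ℤ} (hj : 0 ≤ j)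
    (hU : ∀ m n : ℤ, 0 ≤ n → (P m n ↔ 0 ≤ m ∧ m < A ∧ n ≤ j))
    (hD : UpperShape (GH.mirror L) (GH.mirror P) A k j C t) :
    UpperShape L P A j k (A - C) j := by
  obtain ⟨hC, hCA, ht0, htk, hdn, hrel⟩ := hD
  simp only [GH.mirror] at hdn hrel
  refine ⟨by omega, by omega, hj, le_rfl, fun m n hn => (hU m n hn).trans (by omega), ?_⟩
  refine T.rel_of_corner (p := A - 1) (q := -t) hj ((hU _ _ hj).2 (by omega))
    (fun h => by have := T.bounds h; omega) ((hdn (A - 1) t ht0).2 (by omega))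
    (fun h => by have := T.bounds h; omega) (T.neg_eq hrel (by omega) (by omega))

lemma hasStrictWeight_of_rect (T : IsTile L P A j k) (hj : 0 ≤ j) (hk : 0 ≤ k) (hA : 0 < A)
    (hP : ∀ m n : ℤ, P m n ↔ 0 ≤ m ∧ m < A ∧ -k ≤ n ∧ n ≤ j) (hL : L 0 (j + k + 1)) :
    HasStrictWeight L P := by
  have hjr : (0 : ℝ) ≤ j := by exact_mod_cast hj
  have hkr : (0 : ℝ) ≤ k := by exact_mod_cast hk
  have hAr : (1 : ℝ) ≤ A := by exact_mod_cast hA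
  obtain ⟨β, γ, hβ, hγ, hsum, hval⟩ : ∃ β γ : ℝ, 0 ≤ β ∧ 0 ≤ γ ∧ β + γ = 1 ∧
      γ * (j + k + 1) = j + 1 / 2 := by
    refine ⟨(k + 1 / 2) / (j + k + 1), (j + 1 / 2) / (j + k + 1), by positivity, by positivity,
      ?_, ?_⟩
    · field_simp
      ring
    · field_simp
  refine ⟨j + k + 1, β, γ, by linarith, fun m n m' n' hb hP' hL' => ?_⟩
  obtain ⟨hnot, hb⟩ := hb
  have hnot' := mt (hP m n).2 hnot
  obtain rfl : β = 1 - γ := by linarith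
  rcases hb with hb | ⟨hn, hb⟩ | ⟨hn, hb⟩
  · obtain rfl := T.rep_right hb hnot hP' hL'
    rw [hP] at hb hP'
    have hm : (m : ℝ) = A := by exact_mod_cast (by omega)
    have h1 : 0 ≤ bend (1 - γ) γ n := by
      unfold bend
      positivity
    have h2 : bend (1 - γ) γ n' ≤ j + k := by
      have e1 : ((n'.toNat : ℕ) : ℝ) ≤ j := by exact_mod_cast (by omega : (n'.toNat : ℤ) ≤ j)
      have e2 : (((-n').toNat : ℕ) : ℝ) ≤ k := by
        exact_mod_cast (by omega : ((-n').toNat : ℤ) ≤ k)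
      unfold bend
      nlinarith
    have h3 : (j : ℝ) + k + 1 ≤ (j + k + 1) * A := le_mul_of_one_le_right (by positivity) hAr
    rw [hm, Int.cast_zero, sub_zero]
    linarith
  · rw [hP] at hb
    obtain ⟨rfl, rfl⟩ := T.inj_eq hP' ((hP m (-k)).2 (by omega)) (T.sub_eq hL hL' rfl rfl)
      (by omega) (by omega)
    obtain rfl : n = j + 1 := by omega
    have e1 : (((j + 1).toNat : ℤ) : ℝ) = j + 1 := by exact_mod_cast (by omega)
    have e2 : (((-k).toNat : ℤ) : ℝ) = 0 := by exact_mod_cast (by omega)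
    rw [bend_eq, bend_eq, e1, e2]
    push_cast
    linarith
  · rw [hP] at hb
    obtain ⟨rfl, rfl⟩ := T.inj_eq ((hP m j).2 (by omega)) hP' (T.add_eq hL hL' rfl rfl)
      (by omega) (by omega)
    obtain rfl : n = -k - 1 := by omega
    have e1 : (((-k - 1).toNat : ℤ) : ℝ) = 0 := by exact_mod_cast (by omega)
    have e2 : ((j.toNat : ℤ) : ℝ) = j := by exact_mod_cast (by omega)
    rw [bend_eq, bend_eq, e1, e2]
    push_cast
    linarith

theorem hasStrictWeight (T : IsTile L P A j k) : HasStrictWeight L P := by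
  have hpos : 0 < A ∧ 0 ≤ j ∧ 0 ≤ k := by
    obtain ⟨m, n, h, -⟩ := T.surj 0 0
    have hb := T.bounds h
    have := (T.col 0).1 (T.mono h le_rfl hb.1 (by omega))
    omega
  obtain ⟨hA, hj, hk⟩ := hpos
  rcases T.upper_dichotomy with hU | ⟨B, s, hs, hU⟩ <;>
    rcases T.mirror.upper_dichotomy with hD | ⟨C, t, ht, hD⟩
  · obtain ⟨c, n', hP, hL⟩ := T.surj 0 (j + 1)
    have hb := T.bounds hP
    have hn' : n' ≤ 0 := by
      by_contra hc
      have := T.inj_eq ((T.col j).2 (by omega)) (T.mono (n' := n' - 1) hP hb.1 le_rfl (by omega))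
        hL (by omega) (by omega)
      omega
    have hk' : n' = -k := by
      by_contra hc
      have hP' : P c (n' - 1) := by
        have := (hD c (-(n' - 1)) (by omega)).2 (by omega)
        simpa only [GH.mirror, neg_neg] using this
      have := T.inj_eq ((T.col j).2 (by omega)) hP' hL (by omega) (by omega)
      omega
    subst hk'
    rcases hb.1.eq_or_lt with rfl | hc
    · refine T.hasStrictWeight_of_rect hj hk hA (fun m n => ?_)
        (T.sub_eq hL T.zero (by omega) (by omega))
      rcases le_total 0 n with hn | hn
      · exact (hU m n hn).trans (by omega)
      · have := hD m (-n) (by omega)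
        simp only [GH.mirror, neg_neg] at this
        exact this.trans (by omega)
    · have hD' : UpperShape (GH.mirror L) (GH.mirror P) A k j c k :=
        ⟨hc, hb.2.1, hk, le_rfl, fun m n hn => (hD m n hn).trans (by omega),
          T.neg_eq hL (by omega) (by omega)⟩
      exact T.hasStrictWeight_of_shapes (T.upperShape_of_rect hj hU hD') hD' (by omega)
  · exact T.hasStrictWeight_of_shapes (T.upperShape_of_rect hj hU hD) hD (by omega)
  · have hU' : UpperShape (GH.mirror (GH.mirror L)) (GH.mirror (GH.mirror P)) A j k B s := by
      rwa [mirror_mirror, mirror_mirror]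
    exact T.hasStrictWeight_of_shapes hU (T.mirror.upperShape_of_rect hk hD hU') (by omega)
  · exact T.hasStrictWeight_of_shapes hU hD (T.width_eq_add hU hD hs ht)

end IsTile

lemma wtN_eq {r a : ℕ} (h : a ≤ r) (x y z : ℕ) :
    wtN r a (x, y, z) = (((x : ℤ) + a * ((y : ℤ) - z) : ℤ) : ZMod r) := by
  simp only [wtN, wtZ, toZ, Nat.cast_sub h, CharP.cast_eq_zero]
  push_cast
  ring

/-- The cells of a `G`-set, where `y^n` and `z^n` are placed at heights `n` and `-n`. -/
def cells (Γ : Set N3) (m n : ℤ) : Prop := 0 ≤ m ∧ (m.toNat, n.toNat, (-n).toNat) ∈ Γ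

/-- The relation of having weight zero, in the coordinates of `cells`. -/
def nullWeight (r a : ℕ) (m n : ℤ) : Prop := ((m + a * n : ℤ) : ZMod r) = 0

lemma cells_iff {Γ : Set N3} {x y z : ℕ} (hyz : y = 0 ∨ z = 0) :
    cells Γ x (y - z) ↔ (x, y, z) ∈ Γ := by
  have e1 : ((y : ℤ) - z).toNat = y := by omega
  have e2 : (-((y : ℤ) - z)).toNat = z := by omega
  rw [cells, e1, e2]
  simp

namespace IsGSet

variable {r a : ℕ} {Γ : Set N3}

lemma mono (hΓ : IsGSet r a Γ) {x y z x' y' z' : ℕ} (h : (x, y, z) ∈ Γ) (hx : x' ≤ x)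
    (hy : y' ≤ y) (hz : z' ≤ z) : (x', y', z') ∈ Γ := by
  refine (hΓ.dclosed (x', y', z') (x - x', y - y', z - z') ?_).1
  convert h using 1
  simp only [Prod.mk_add_mk, Prod.mk.injEq]
  omega

lemma finite (hΓ : IsGSet r a Γ) (hr : 0 < r) : Γ.Finite := by
  have : NeZero r := ⟨hr.ne'⟩
  exact Set.Finite.of_finite_image (Set.toFinite _) hΓ.bij.injOn

lemma y_or_z_eq_zero (hΓ : IsGSet r a Γ) (h : a ≤ r) {x y z : ℕ} (hm : (x, y, z) ∈ Γ) :
    y = 0 ∨ z = 0 := by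
  by_contra hc
  have h1 := hΓ.mono hm (Nat.zero_le x) (show 1 ≤ y by omega) (show 1 ≤ z by omega)
  have := hΓ.bij.injOn h1 hΓ.zero_mem (by rw [wtN_eq h, wtN_eq h]; simp)
  simp at this

lemma wtG_spec (hΓ : IsGSet r a Γ) (v : N3) :
    wtG r a Γ v ∈ Γ ∧ wtN r a (wtG r a Γ v) = wtN r a v := by
  have h : ∃ w, w ∈ Γ ∧ wtN r a w = wtN r a v := hΓ.bij.surjOn (Set.mem_univ _)
  rw [wtG, dif_pos h]
  exact h.choose_spec

lemma wtG_unique (hΓ : IsGSet r a Γ) {v w : N3} (hw : w ∈ Γ) (h : wtN r a w = wtN r a v) :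
    wtG r a Γ v = w :=
  hΓ.bij.injOn (hΓ.wtG_spec v).1 hw ((hΓ.wtG_spec v).2.trans h.symm)

lemma isTile (hΓ : IsGSet r a Γ) (hr : 0 < r) (h : a ≤ r) :
    ∃ A j k : ℤ, IsTile (nullWeight r a) (cells Γ) A j k := by
  have hmono : ∀ {m n m' n' : ℤ}, cells Γ m n → 0 ≤ m' → m' ≤ m →
      (0 ≤ n' ∧ n' ≤ n ∨ n ≤ n' ∧ n' ≤ 0) → cells Γ m' n' := fun hP h0 hm hn =>
    ⟨h0, hΓ.mono hP.2 (by omega) (by omega) (by omega)⟩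
  obtain ⟨⟨bx, cy, bz⟩, hb⟩ := (hΓ.finite hr).bddAbove
  have hb' : ∀ m n : ℤ, cells Γ m n → m ≤ bx ∧ n ≤ cy ∧ -n ≤ bz := by
    intro m n hP
    have := hb hP.2
    simp only [Prod.mk_le_mk] at this
    omega
  have h00 : cells Γ 0 0 := ⟨le_rfl, hΓ.zero_mem⟩
  obtain ⟨i, hi0, hi, himax⟩ := exists_greatest (Q := fun m => cells Γ m 0) h00
    (fun m hm => (hb' _ _ hm).1)
  obtain ⟨j, hj0, hj, hjmax⟩ := exists_greatest (Q := fun n => cells Γ 0 n) h00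
    (fun n hn => (hb' _ _ hn).2.1)
  obtain ⟨k, hk0, hk, hkmax⟩ := exists_greatest (Q := fun n => cells Γ 0 (-n)) (x := 0) (b := bz) h00
    (fun n hn => by have := (hb' 0 (-n) hn).2.2; omega)
  refine ⟨i + 1, j, k, ?_, ?_, fun hP => hP.1, hmono, ?_, ?_, fun m => ⟨fun hP => ?_, fun hm => ?_⟩,
    fun n => ⟨fun hP => ?_, fun hn => ?_⟩⟩
  · simp [nullWeight]
  · intro m n m' n' h1 h2
    unfold nullWeight at *
    have e : (m - m' + a * (n - n') : ℤ) = (m + a * n) - (m' + a * n') := by ring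
    rw [e, Int.cast_sub, h1, h2, sub_zero]
  · intro m n m' n' h1 h2 hL
    have e : wtN r a (m.toNat, n.toNat, (-n).toNat) = wtN r a (m'.toNat, n'.toNat, (-n').toNat) := by
      have a1 := h1.1
      have a2 := h2.1
      have e1 : (m.toNat : ℤ) = m := by omega
      have e2 : (m'.toNat : ℤ) = m' := by omega
      have e3 : (n.toNat : ℤ) - (-n).toNat = n := by omega
      have e4 : (n'.toNat : ℤ) - (-n').toNat = n' := by omega
      rw [wtN_eq h, wtN_eq h, e1, e2, e3, e4, ← sub_eq_zero, ← Int.cast_sub]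
      unfold nullWeight at hL
      convert hL using 2
      ring
    have := hΓ.bij.injOn h1.2 h2.2 e
    simp only [Prod.mk.injEq] at this
    have a1 := h1.1
    have a2 := h2.1
    omega
  · intro m n
    obtain ⟨⟨x, y, z⟩, hw, e⟩ := hΓ.bij.surjOn (Set.mem_univ ((m + a * n : ℤ) : ZMod r))
    refine ⟨x, y - z, (cells_iff (hΓ.y_or_z_eq_zero h hw)).2 hw, ?_⟩
    rw [wtN_eq h, eq_comm, ← sub_eq_zero, ← Int.cast_sub] at e
    unfold nullWeight
    convert e using 2
    ring
  · have := himax _ hP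
    exact ⟨hP.1, by omega⟩
  · exact hmono hi hm.1 (by omega) (by omega)
  · have h1 : n ≤ j := hjmax _ hP
    have h2 : -n ≤ k := hkmax _ (by simpa using hP)
    omega
  · rcases le_total 0 n with h0 | h0
    · exact hmono hj le_rfl le_rfl (by omega)
    · exact hmono hk le_rfl le_rfl (by omega)

/-- A weight that is strict on the border of `Γ` is nonnegative on every `s_Γ(v)`. -/
lemma mem_sigmaCone (hΓ : IsGSet r a Γ) {α : ℝ × ℝ × ℝ}
    (hα : ∀ w ∈ Γ, ∀ e ∈ ({(1, 0, 0), (0, 1, 0), (0, 0, 1)} : Finset N3), w + e ∉ Γ →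
      0 < dotR α (sG r a Γ (w + e))) : α ∈ sigmaCone r a Γ := by
  have hself : ∀ v ∈ Γ, dotR α (sG r a Γ v) = 0 := by
    intro v hv
    rw [sG, hΓ.wtG_unique hv rfl, sub_self]
    simp [dotR]
  have hadd : ∀ u w : Z3, dotR α (u + w) = dotR α u + dotR α w := by
    intro u w
    simp only [dotR, Prod.fst_add, Prod.snd_add, Int.cast_add]
    ring
  have htoZ : ∀ u w : N3, toZ (u + w) = toZ u + toZ w := by
    intro u w
    simp [toZ]
  have hwt : ∀ u w : N3, wtN r a (u + w) = wtN r a u + wtN r a w := by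
    intro u w
    simp only [wtN, wtZ, htoZ, Prod.fst_add, Prod.snd_add, Int.cast_add]
    ring
  have step : ∀ u e : N3, e ∈ ({(1, 0, 0), (0, 1, 0), (0, 0, 1)} : Finset N3) →
      0 ≤ dotR α (sG r a Γ u) → 0 ≤ dotR α (sG r a Γ (u + e)) := by
    intro u e he hu
    obtain ⟨hw, hwu⟩ := hΓ.wtG_spec u
    have hEq : wtG r a Γ (u + e) = wtG r a Γ (wtG r a Γ u + e) :=
      hΓ.wtG_unique (hΓ.wtG_spec _).1 (by rw [(hΓ.wtG_spec _).2, hwt, hwt, hwu])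
    have hs : sG r a Γ (u + e) = sG r a Γ u + sG r a Γ (wtG r a Γ u + e) := by
      simp only [sG, hEq, htoZ]
      abel
    rw [hs, hadd]
    refine add_nonneg hu ?_
    by_cases hin : wtG r a Γ u + e ∈ Γ
    · exact (hself _ hin).ge
    · exact (hα _ hw e he hin).le
  rintro ⟨x, y, z⟩
  induction x with
  | succ x ih => exact step (x, y, z) (1, 0, 0) (by simp) ih
  | zero =>
    induction y with
    | succ y ih => exact step (0, y, z) (0, 1, 0) (by simp) ih
    | zero =>
      induction z with
      | succ z ih => exact step (0, 0, z) (0, 0, 1) (by simp) ih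
      | zero => exact (hself _ hΓ.zero_mem).ge

lemma exists_strict (hΓ : IsGSet r a Γ) (hr : 0 < r) (h : a ≤ r) :
    ∃ α : ℝ × ℝ × ℝ, ∀ w ∈ Γ, ∀ e ∈ ({(1, 0, 0), (0, 1, 0), (0, 0, 1)} : Finset N3),
      w + e ∉ Γ → 0 < dotR α (sG r a Γ (w + e)) := by
  obtain ⟨A, j, k, T⟩ := hΓ.isTile hr h
  obtain ⟨α, β, γ, hpos, hα⟩ := T.hasStrictWeight
  have key : ∀ x y z : ℕ, y = 0 ∨ z = 0 → IsBorder (cells Γ) x (y - z) →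
      0 < dotR (α, β, γ) (sG r a Γ (x, y, z)) := by
    intro x y z hyz hb
    obtain ⟨hw, e⟩ := hΓ.wtG_spec (x, y, z)
    rw [sG]
    generalize wtG r a Γ (x, y, z) = w at *
    obtain ⟨x', y', z'⟩ := w
    have hyz' := hΓ.y_or_z_eq_zero h hw
    rw [wtN_eq h, wtN_eq h, eq_comm, ← sub_eq_zero, ← Int.cast_sub] at e
    have := hα x (y - z) x' (y' - z') hb ((cells_iff hyz').2 hw) (by
      unfold nullWeight
      convert e using 2
      ring)
    have e1 : ((y : ℤ) - z).toNat = y := by omega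
    have e2 : (-((y : ℤ) - z)).toNat = z := by omega
    have e3 : ((y' : ℤ) - z').toNat = y' := by omega
    have e4 : (-((y' : ℤ) - z')).toNat = z' := by omega
    simp only [bend, e1, e2, e3, e4] at this
    simp only [dotR, toZ, Prod.mk_sub_mk]
    push_cast at this ⊢
    linarith
  have hyz : ∀ x y z : ℕ, (x, y, z) ∈ Γ → 0 < dotR (α, β, γ) (sG r a Γ (x, y + 1, z + 1)) := by
    intro x y z hw
    rw [sG, hΓ.wtG_unique hw (by rw [wtN_eq h, wtN_eq h]; push_cast; ring)]
    simp only [dotR, toZ, Prod.mk_sub_mk]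
    push_cast
    linarith
  refine ⟨(α, β, γ), ?_⟩
  rintro ⟨x, y, z⟩ hw e he hnot
  have h0 := hΓ.y_or_z_eq_zero h hw
  have hc := (cells_iff h0).2 hw
  simp only [Finset.mem_insert, Finset.mem_singleton] at he
  rcases he with rfl | rfl | rfl <;> simp only [Prod.mk_add_mk, add_zero] at hnot ⊢
  · refine key _ _ _ h0 ⟨mt (cells_iff h0).1 hnot, Or.inl ?_⟩
    push_cast
    simpa using hc
  · rcases z with _ | z
    · refine key _ _ _ (Or.inr rfl) ⟨mt (cells_iff (Or.inr rfl)).1 hnot, Or.inr (Or.inl ?_)⟩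
      push_cast
      exact ⟨by omega, by simpa using hc⟩
    · exact hyz x y z (hΓ.mono hw le_rfl le_rfl (by omega))
  · rcases y with _ | y
    · refine key _ _ _ (Or.inl rfl) ⟨mt (cells_iff (Or.inl rfl)).1 hnot, Or.inr (Or.inr ?_)⟩
      push_cast
      exact ⟨by omega, by simpa using hc⟩
    · exact hyz x y z (hΓ.mono hw le_rfl (by omega) le_rfl)

end IsGSet

/-- For every `G`-set `Γ`, the cone `σ(Γ)` is 3-dimensional,
i.e. it has nonempty interior in `ℝ³`. -/
theorem stmt5 (r a : ℕ) (hra : Nat.Coprime r a) (ha2 : 2 ≤ a) (halt : a < r - a) (Γ : Set N3) (hΓ : IsGSet r a Γ) :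
    (interior (sigmaCone r a Γ)).Nonempty := by
  have hr : 0 < r := by omega
  obtain ⟨α, hα⟩ := hΓ.exists_strict hr (by omega)
  refine ⟨α, mem_interior.2 ⟨{β | ∀ w ∈ Γ,
    ∀ e ∈ ({(1, 0, 0), (0, 1, 0), (0, 0, 1)} : Finset N3), w + e ∉ Γ →
      0 < dotR β (sG r a Γ (w + e))}, fun β hβ => hΓ.mem_sigmaCone hβ, ?_, hα⟩⟩
  simp only [Set.ofPred_forall]
  refine (hΓ.finite hr).isOpen_biInter fun w _ => isOpen_biInter_finset fun e _ =>
    isOpen_iInter_of_finite fun _ => isOpen_lt continuous_const ?_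
  unfold dotR
  fun_prop

end GH
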